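/- arXiv:1211.0346 — 2 statements merged into one kernel-verified Lean document; each statement's English description precedes it below -/
import Mathlib

section
/- Let A, B, C ∈ ℂ^{m×n}. If ηγ ≠ 1 for all eigenvalues η, γ of ABᵀ, then the Stein equation W = ABᵀWAᵀB + ACᵀB + C has a unique solution W★ ∈ ℂ^{m×n}, and the equation X = AXᵀB + C has a unique solution X★ ∈ ℂ^{m×n} with X★ = W★. -/
open Matrix

/-- A scalar by which a square matrix acts on some nonzero matrix lies in the spectrum. -/
theorem Matrix.mem_spectrum_of_mul_eq_smul {K m n : Type*} [Field K] [Fintype m] [DecidableEq m]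
    {P : Matrix m m K} {Y : Matrix m n K} {c : K} (hY : Y ≠ 0) (h : P * Y = c • Y) :
    c ∈ spectrum K P := by
  rw [spectrum.mem_iff]
  rintro ⟨u, hu⟩
  have h0 : (u : Matrix m m K) * Y = 0 := by
    rw [hu, Matrix.sub_mul, h, Algebra.algebraMap_eq_smul_one, Matrix.smul_mul, Matrix.one_mul,
      sub_self]
  apply hY
  calc Y = ((u⁻¹ : (Matrix m m K)ˣ) : Matrix m m K) * ((u : Matrix m m K) * Y) := by
        rw [← Matrix.mul_assoc, Units.inv_mul, Matrix.one_mul]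
    _ = 0 := by rw [h0, Matrix.mul_zero]

/-- The homogeneous Stein equation `Y = P Y Pᵀ` has only the zero solution if no two eigenvalues
of `P` multiply to `1`. -/
theorem Matrix.eq_zero_of_eq_mul_mul_transpose {K m : Type*} [Field K] [IsAlgClosed K]
    [Fintype m] [DecidableEq m] {P : Matrix m m K}
    (hspec : ∀ η ∈ spectrum K P, ∀ γ ∈ spectrum K P, η * γ ≠ 1)
    {Y : Matrix m m K} (h : Y = P * Y * Pᵀ) : Y = 0 := by
  by_contra hY
  let R : Module.End K (Matrix m m K) := LinearMap.mulRight K Pᵀ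
  let E : Submodule K (Matrix m m K) :=
    LinearMap.eqLocus LinearMap.id (LinearMap.mulRight K Pᵀ ∘ₗ LinearMap.mulLeft K P)
  have mem_E (Z : Matrix m m K) : Z ∈ E ↔ Z = P * Z * Pᵀ := Iff.rfl
  have hR : ∀ Z ∈ E, R Z ∈ E := by
    intro Z hZ
    rw [mem_E] at hZ ⊢
    change Z * Pᵀ = P * (Z * Pᵀ) * Pᵀ
    rw [← Matrix.mul_assoc P, ← hZ]
  have : Nontrivial E := ⟨⟨Y, h⟩, 0, fun h0 => hY (congrArg Subtype.val h0)⟩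
  obtain ⟨γ, hγ⟩ := Module.End.exists_eigenvalue (R.restrict hR)
  obtain ⟨⟨Z, hZE⟩, hZ⟩ := hγ.exists_hasEigenvector
  have hZ0 : Z ≠ 0 := fun h0 => hZ.2 (Subtype.ext h0)
  have hZγ : Z * Pᵀ = γ • Z := congrArg Subtype.val hZ.apply_eq_smul
  rw [mem_E, Matrix.mul_assoc, hZγ, Matrix.mul_smul] at hZE
  have hγ0 : γ ≠ 0 := by
    rintro rfl
    exact hZ0 (by rw [hZE, zero_smul])
  refine hspec γ⁻¹ (mem_spectrum_of_mul_eq_smul hZ0 ?_) γ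
    (mem_spectrum_of_mul_eq_smul (Y := Zᵀ) (by simpa using hZ0) ?_) (inv_mul_cancel₀ hγ0)
  · rw [eq_inv_smul_iff₀ hγ0, ← hZE]
  · rw [← transpose_smul, ← hZγ, transpose_mul, transpose_transpose]

/-- The homogeneous equation `W = A Bᵀ W Aᵀ B` has only the zero solution if no two eigenvalues
of `A Bᵀ` multiply to `1`. -/
theorem Matrix.eq_zero_of_eq_mul_transpose_mul_transpose_mul {K m n : Type*} [Field K]
    [IsAlgClosed K] [Fintype m] [DecidableEq m] [Fintype n] {A B : Matrix m n K}
    (hspec : ∀ η ∈ spectrum K (A * Bᵀ), ∀ γ ∈ spectrum K (A * Bᵀ), η * γ ≠ 1)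
    {W : Matrix m n K} (h : W = A * Bᵀ * W * Aᵀ * B) : W = 0 := by
  have hWA : W * Aᵀ = 0 := by
    refine eq_zero_of_eq_mul_mul_transpose hspec ?_
    conv_lhs => rw [h]
    simp only [transpose_mul, transpose_transpose, Matrix.mul_assoc]
  rw [h, Matrix.mul_assoc (A * Bᵀ), hWA, Matrix.mul_zero, Matrix.zero_mul]

/-- If `ηγ ≠ 1` for all eigenvalues `η, γ` of `ABᵀ`, then the Stein
equation `W = ABᵀWAᵀB + ACᵀB + C` has a unique solution `W★`, the equation `X = AXᵀB + C`
has a unique solution `X★`, and `X★ = W★`. -/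
theorem eq_AXTB_unique_of_spectrum {m n : ℕ} (A B C : Matrix (Fin m) (Fin n) ℂ)
    (hspec : ∀ η ∈ spectrum ℂ (A * Bᵀ), ∀ γ ∈ spectrum ℂ (A * Bᵀ), η * γ ≠ 1) :
    ∃ X₀ : Matrix (Fin m) (Fin n) ℂ,
      (X₀ = A * Bᵀ * X₀ * Aᵀ * B + A * Cᵀ * B + C ∧
        ∀ W : Matrix (Fin m) (Fin n) ℂ,
          W = A * Bᵀ * W * Aᵀ * B + A * Cᵀ * B + C → W = X₀) ∧
      (X₀ = A * X₀ᵀ * B + C ∧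
        ∀ X : Matrix (Fin m) (Fin n) ℂ, X = A * Xᵀ * B + C → X = X₀) := by
  let T : Module.End ℂ (Matrix (Fin m) (Fin n) ℂ) :=
    { toFun := fun W => W - A * Bᵀ * W * Aᵀ * B
      map_add' := fun X Y => by simp only [Matrix.mul_add, Matrix.add_mul]; abel
      map_smul' := fun c X => by
        simp only [Matrix.mul_smul, Matrix.smul_mul, smul_sub, RingHom.id_apply] }
  have T_apply (W) : T W = W - A * Bᵀ * W * Aᵀ * B := rfl
  have stein_iff (W) : W = A * Bᵀ * W * Aᵀ * B + A * Cᵀ * B + C ↔ T W = A * Cᵀ * B + C := by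
    rw [T_apply, sub_eq_iff_eq_add', add_assoc]
  have hinj : Function.Injective T := (injective_iff_map_eq_zero T).2 fun W hW =>
    eq_zero_of_eq_mul_transpose_mul_transpose_mul hspec (sub_eq_zero.1 hW)
  have iterate (X : Matrix (Fin m) (Fin n) ℂ) :
      A * (A * Xᵀ * B + C)ᵀ * B = A * Bᵀ * X * Aᵀ * B + A * Cᵀ * B := by
    simp only [transpose_add, transpose_mul, transpose_transpose, Matrix.mul_add, Matrix.add_mul,
      Matrix.mul_assoc]
  obtain ⟨X₀, hX₀⟩ := LinearMap.injective_iff_surjective.1 hinj (A * Cᵀ * B + C)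
  have huniq (W) (hW : W = A * Bᵀ * W * Aᵀ * B + A * Cᵀ * B + C) : W = X₀ :=
    hinj (((stein_iff W).1 hW).trans hX₀.symm)
  have hstein := (stein_iff X₀).2 hX₀
  refine ⟨X₀, ⟨hstein, huniq⟩, (huniq _ ?_).symm, fun X hX => huniq X ?_⟩
  · rw [← iterate, iterate X₀, ← hstein]
  · rw [← iterate, ← hX, ← hX]
end

section
/- Let A, B, C ∈ ℂ^{m×n}. The Smith iteration X_{k+1} = A·X_kᴴ·B + C converges, for every initial matrix X₀ ∈ ℂ^{m×n}, to the unique solution X★ of the equation X = AXᴴB + C if and only if ρ(BᴴA) < 1. (In particular, when ρ(BᴴA) < 1 the equation has a unique solution and the iteration converges to it for every X₀; conversely, if the iteration converges for every X₀ then ρ(BᴴA) < 1.) -/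
open Matrix Filter

/-- In a complex Banach algebra, the powers of an element of spectral radius less than one tend
to zero. -/
theorem tendsto_pow_nhds_zero_of_spectralRadius_lt_one {R : Type*} [NormedRing R]
    [NormedAlgebra ℂ R] [CompleteSpace R] {a : R} (ha : spectralRadius ℂ a < 1) :
    Tendsto (fun k : ℕ => a ^ k) atTop (nhds 0) := by
  obtain ⟨r, har, hr1⟩ := ENNReal.lt_iff_exists_nnreal_btwn.1 ha
  have hr : (r : ℝ) < 1 := by exact_mod_cast hr1
  refine squeeze_zero_norm' ?_ (tendsto_pow_atTop_nhds_zero_of_lt_one r.coe_nonneg hr)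
  filter_upwards [(spectrum.pow_nnnorm_pow_one_div_tendsto_nhds_spectralRadius a).eventually_lt_const
    har, eventually_gt_atTop 0] with k hk hk0
  have hk0' : (0 : ℝ) < k := by exact_mod_cast hk0
  rw [one_div, ENNReal.rpow_inv_lt_iff hk0', ENNReal.rpow_natCast] at hk
  exact_mod_cast hk.le

theorem tendsto_atTop_of_even_of_odd {α : Type*} {l : Filter α} {u : ℕ → α}
    (heven : Tendsto (fun k => u (2 * k)) atTop l)
    (hodd : Tendsto (fun k => u (2 * k + 1)) atTop l) : Tendsto u atTop l := by
  intro s hs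
  obtain ⟨a, ha⟩ := eventually_atTop.1 (heven hs)
  obtain ⟨b, hb⟩ := eventually_atTop.1 (hodd hs)
  refine eventually_atTop.2 ⟨2 * a + 2 * b, fun k hk => ?_⟩
  rcases Nat.even_or_odd' k with ⟨j, rfl | rfl⟩
  · exact ha j (by omega)
  · exact hb j (by omega)

theorem Matrix.tendsto_pow_nhds_zero_of_spectralRadius_lt_one {ι : Type*} [Fintype ι]
    [DecidableEq ι] {M : Matrix ι ι ℂ} (hM : spectralRadius ℂ M < 1) :
    Tendsto (fun k : ℕ => M ^ k) atTop (nhds 0) := by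
  let _ : NormedRing (Matrix ι ι ℂ) := Matrix.linftyOpNormedRing
  let _ : NormedAlgebra ℂ (Matrix ι ι ℂ) := Matrix.linftyOpNormedAlgebra
  have : CompleteSpace (Matrix ι ι ℂ) := FiniteDimensional.complete ℂ _
  exact _root_.tendsto_pow_nhds_zero_of_spectralRadius_lt_one hM

theorem Matrix.exists_mem_spectrum_one_le_norm {ι : Type*} [Fintype ι] [DecidableEq ι]
    {M : Matrix ι ι ℂ} (hM : 1 ≤ spectralRadius ℂ M) :
    ∃ z ∈ spectrum ℂ M, 1 ≤ ‖z‖ := by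
  let _ : NormedRing (Matrix ι ι ℂ) := Matrix.linftyOpNormedRing
  let _ : NormedAlgebra ℂ (Matrix ι ι ℂ) := Matrix.linftyOpNormedAlgebra
  have : CompleteSpace (Matrix ι ι ℂ) := FiniteDimensional.complete ℂ _
  rcases subsingleton_or_nontrivial (Matrix ι ι ℂ) with h | h
  · simp [spectrum.SpectralRadius.of_subsingleton] at hM
  · obtain ⟨z, hz, hzM⟩ := spectrum.exists_nnnorm_eq_spectralRadius M
    refine ⟨z, hz, ?_⟩
    rw [← hzM] at hM
    exact_mod_cast hM

section StarSylvester

variable {ι κ : Type*} [Fintype ι] [Fintype κ]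

/-- The real-linear part `X ↦ A Xᴴ B` of the Smith iteration. -/
def starSylvesterMap (A B : Matrix ι κ ℂ) : Module.End ℝ (Matrix ι κ ℂ) where
  toFun X := A * Xᴴ * B
  map_add' X Y := by simp [Matrix.mul_add, Matrix.add_mul]
  map_smul' r X := by simp [conjTranspose_smul]

variable (A B : Matrix ι κ ℂ)

theorem starSylvesterMap_apply (X : Matrix ι κ ℂ) : starSylvesterMap A B X = A * Xᴴ * B := rfl

theorem starSylvesterMap_pow_two_apply (X : Matrix ι κ ℂ) :
    (starSylvesterMap A B ^ 2) X = A * Bᴴ * X * (Bᴴ * A)ᴴ := by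
  simp [pow_two, starSylvesterMap_apply, conjTranspose_mul, Matrix.mul_assoc]

theorem starSylvesterMap_pow_two_mul_succ_apply [DecidableEq κ] (X : Matrix ι κ ℂ) (k : ℕ) :
    (starSylvesterMap A B ^ (2 * (k + 1))) X =
      A * (Bᴴ * A) ^ k * (Bᴴ * X) * ((Bᴴ * A) ^ (k + 1))ᴴ := by
  induction k with
  | zero => simp [starSylvesterMap_pow_two_apply, Matrix.mul_assoc]
  | succ k ih =>
    rw [show 2 * (k + 1 + 1) = 2 + 2 * (k + 1) by ring, pow_add, Module.End.mul_apply, ih,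
      starSylvesterMap_pow_two_apply, pow_succ' (Bᴴ * A) (k + 1), conjTranspose_mul (Bᴴ * A),
      pow_succ' (Bᴴ * A) k]
    simp only [Matrix.mul_assoc]

theorem continuous_starSylvesterMap : Continuous (starSylvesterMap A B) :=
  (continuous_const.matrix_mul continuous_id.matrix_conjTranspose).matrix_mul continuous_const

theorem tendsto_starSylvesterMap_pow [DecidableEq κ] (h : spectralRadius ℂ (Bᴴ * A) < 1)
    (X : Matrix ι κ ℂ) :
    Tendsto (fun k : ℕ => (starSylvesterMap A B ^ k) X) atTop (nhds 0) := by
  have hpow := Matrix.tendsto_pow_nhds_zero_of_spectralRadius_lt_one h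
  have heven' : Tendsto (fun k : ℕ => (starSylvesterMap A B ^ (2 * (k + 1))) X) atTop
      (nhds 0) := by
    simp_rw [starSylvesterMap_pow_two_mul_succ_apply]
    have hc : Continuous fun p : Matrix κ κ ℂ × Matrix κ κ ℂ => A * p.1 * (Bᴴ * X) * p.2ᴴ := by
      fun_prop
    have hpow' : Tendsto (fun k : ℕ => (Bᴴ * A) ^ (k + 1)) atTop (nhds 0) :=
      hpow.comp (tendsto_add_atTop_nat 1)
    have hc0 := hc.tendsto (0, 0)
    simp only [Matrix.mul_zero, Matrix.zero_mul, conjTranspose_zero] at hc0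
    have hp := hpow.prodMk_nhds hpow'
    have hlim := hc0.comp hp
    exact hlim
  have heven : Tendsto (fun k : ℕ => (starSylvesterMap A B ^ (2 * k)) X) atTop (nhds 0) :=
    (tendsto_add_atTop_iff_nat 1).1 heven'
  have hodd : Tendsto (fun k : ℕ => (starSylvesterMap A B ^ (2 * k + 1)) X) atTop (nhds 0) := by
    simp_rw [pow_succ', Module.End.mul_apply]
    have hc := (continuous_starSylvesterMap A B).tendsto 0
    rw [map_zero] at hc
    exact hc.comp heven
  exact tendsto_atTop_of_even_of_odd heven hodd

theorem exists_unique_fixedPoint_starSylvesterMap (C : Matrix ι κ ℂ)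
    (h : ∀ X, Tendsto (fun k : ℕ => (starSylvesterMap A B ^ k) X) atTop (nhds 0)) :
    ∃ X, X = starSylvesterMap A B X + C ∧ ∀ Y, Y = starSylvesterMap A B Y + C → Y = X := by
  have hinj : Function.Injective (1 - starSylvesterMap A B : Module.End ℝ (Matrix ι κ ℂ)) := by
    rw [← LinearMap.ker_eq_bot, LinearMap.ker_eq_bot']
    intro X hX
    have hfix : starSylvesterMap A B X = X := (sub_eq_zero.1 hX).symm
    have hconst (k : ℕ) : (starSylvesterMap A B ^ k) X = X := by
      rw [Module.End.pow_apply]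
      exact Function.iterate_fixed hfix k
    have := h X
    simp_rw [hconst] at this
    exact tendsto_nhds_unique tendsto_const_nhds this
  obtain ⟨X, hX⟩ := LinearMap.injective_iff_surjective.1 hinj C
  refine ⟨X, ?_, fun Y hY => hinj ?_⟩
  · rw [← hX]; simp
  · rw [hX]
    exact sub_eq_iff_eq_add'.2 hY

theorem smithIteration_sub_fixedPoint {C Xs : Matrix ι κ ℂ}
    (hXs : Xs = starSylvesterMap A B Xs + C) {X : ℕ → Matrix ι κ ℂ}
    (hX : ∀ k, X (k + 1) = starSylvesterMap A B (X k) + C) (k : ℕ) :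
    X k - Xs = (starSylvesterMap A B ^ k) (X 0 - Xs) := by
  induction k with
  | zero => simp
  | succ k ih =>
    rw [pow_succ', Module.End.mul_apply, ← ih, map_sub, hX]
    nth_rewrite 1 [hXs]
    abel

theorem exists_starSylvesterMap_pow_two_eq_smul [DecidableEq κ] {z : ℂ} (hz0 : z ≠ 0)
    (hz : z ∈ spectrum ℂ (Bᴴ * A)) :
    ∃ X ≠ 0, (starSylvesterMap A B ^ 2) X = (‖z‖ ^ 2) • X := by
  rw [← Matrix.spectrum_toLin', ← Module.End.hasEigenvalue_iff_mem_spectrum] at hz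
  obtain ⟨v, hv⟩ := hz.exists_hasEigenvector
  have hzv : (Bᴴ * A) *ᵥ v = z • v := by simpa using hv.apply_eq_smul
  have hAv : A *ᵥ v ≠ 0 := by
    intro h0
    rw [← mulVec_mulVec, h0, mulVec_zero] at hzv
    exact smul_ne_zero hz0 hv.2 hzv.symm
  refine ⟨vecMulVec (A *ᵥ v) (star v), ?_, ?_⟩
  · obtain ⟨i, hi⟩ := Function.ne_iff.1 hAv
    obtain ⟨j, hj⟩ := Function.ne_iff.1 hv.2
    exact fun h0 => mul_ne_zero hi (star_ne_zero.2 hj) (congr_fun₂ h0 i j)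
  · have hleft : A * Bᴴ * vecMulVec (A *ᵥ v) (star v) = z • vecMulVec (A *ᵥ v) (star v) := by
      rw [mul_vecMulVec, mulVec_mulVec, Matrix.mul_assoc, ← mulVec_mulVec, hzv, mulVec_smul,
        smul_vecMulVec]
    have hright : star v ᵥ* (Bᴴ * A)ᴴ = star z • star v := by
      rw [← star_mulVec, hzv, star_smul]
    rw [starSylvesterMap_pow_two_apply, hleft, Matrix.smul_mul, vecMulVec_mul, hright,
      vecMulVec_smul, smul_smul, Complex.star_def, Complex.mul_conj, Complex.normSq_eq_norm_sq]
    ext i j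
    simp

theorem spectralRadius_lt_one_of_tendsto_starSylvesterMap_pow [DecidableEq κ]
    (h : ∀ X, Tendsto (fun k : ℕ => (starSylvesterMap A B ^ k) X) atTop (nhds 0)) :
    spectralRadius ℂ (Bᴴ * A) < 1 := by
  by_contra! hρ
  obtain ⟨z, hz, hz1⟩ := Matrix.exists_mem_spectrum_one_le_norm hρ
  have hz0 : z ≠ 0 := norm_pos_iff.1 (zero_lt_one.trans_le hz1)
  obtain ⟨X, hX0, hX⟩ := exists_starSylvesterMap_pow_two_eq_smul A B hz0 hz
  have hpow (k : ℕ) : (starSylvesterMap A B ^ (2 * k)) X = ((‖z‖ ^ 2) ^ k) • X := by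
    induction k with
    | zero => simp
    | succ k ih =>
      rw [mul_add, mul_one, pow_add, Module.End.mul_apply, hX, map_smul, ih, smul_smul,
        ← pow_succ']
  have hlim := (h X).comp (tendsto_id.const_mul_atTop' (two_pos : (0 : ℕ) < 2))
  simp only [Function.comp_def, id, hpow] at hlim
  obtain ⟨i, j, hij⟩ : ∃ i j, X i j ≠ 0 := by
    by_contra! h0
    exact hX0 (Matrix.ext h0)
  have hentry := ((continuous_norm.comp (continuous_id.matrix_elem i j)).tendsto _).comp hlim
  have hle : ‖X i j‖ ≤ 0 := by
    refine ge_of_tendsto (by simpa [Function.comp_def] using hentry) (Eventually.of_forall ?_)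
    exact fun k => le_mul_of_one_le_left (norm_nonneg _) (one_le_pow₀ (one_le_pow₀ hz1))
  exact hij (norm_le_zero_iff.1 hle)

end StarSylvester

/-- The Smith iteration `X_{k+1} = AX_kᴴB + C` converges, for every
initial matrix, to the unique solution of `X = AXᴴB + C` iff `ρ(BᴴA) < 1`. -/
theorem smith_iteration_AXHB_converges_iff {m n : ℕ} (A B C : Matrix (Fin m) (Fin n) ℂ) :
    (∃ Xs : Matrix (Fin m) (Fin n) ℂ,
      (Xs = A * Xsᴴ * B + C ∧
        ∀ Y : Matrix (Fin m) (Fin n) ℂ, Y = A * Yᴴ * B + C → Y = Xs) ∧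
      ∀ X : ℕ → Matrix (Fin m) (Fin n) ℂ,
        (∀ k : ℕ, X (k + 1) = A * (X k)ᴴ * B + C) →
        Tendsto X atTop (nhds Xs)) ↔
    spectralRadius ℂ (Bᴴ * A) < 1 := by
  simp only [← starSylvesterMap_apply]
  constructor
  · rintro ⟨Xs, ⟨hXs, -⟩, hconv⟩
    refine spectralRadius_lt_one_of_tendsto_starSylvesterMap_pow A B fun Z => ?_
    let X : ℕ → Matrix (Fin m) (Fin n) ℂ := fun k =>
      (fun Y => starSylvesterMap A B Y + C)^[k] (Xs + Z)
    have hX (k : ℕ) : X (k + 1) = starSylvesterMap A B (X k) + C :=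
      Function.iterate_succ_apply' _ _ _
    have hlim := (hconv X hX).sub_const Xs
    rw [sub_self, funext (smithIteration_sub_fixedPoint A B hXs hX),
      show X 0 - Xs = Z from add_sub_cancel_left Xs Z] at hlim
    exact hlim
  · intro hρ
    have hpow := tendsto_starSylvesterMap_pow A B hρ
    obtain ⟨Xs, hXs, huniq⟩ := exists_unique_fixedPoint_starSylvesterMap A B C hpow
    refine ⟨Xs, ⟨hXs, huniq⟩, fun X hX => ?_⟩
    rw [← tendsto_sub_nhds_zero_iff]
    exact (hpow (X 0 - Xs)).congr fun k => (smithIteration_sub_fixedPoint A B hXs hX k).symm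
end
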